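/- Let A ∈ ℝ_max^{N×N}, B ∈ ℝ_max^{N×m}, let K ⊆ ℝ_max^N be a semimodule, and define φ(X) = X ∩ { x : ∃ u ∈ ℝ_max^m, A ⊗ x ⊕ B ⊗ u ∈ X } with φ^0(K) = K and φ^{k+1}(K) = φ(φ^k(K)), and let K^♯ = { x ∈ K : ∃ u : ℕ → ℝ_max^m such that the trajectory x(1) = x, x(k+1) = A ⊗ x(k) ⊕ B ⊗ u(k) satisfies x(k) ∈ K for all k }. Then: (i) K^♯ ⊆ φ^k(K) for every k ∈ ℕ₀; and (ii) if φ^{k+1}(K) = φ^k(K) for some k ∈ ℕ₀, then φ^k(K) = K^♯, the maximal (A,B)-invariant subsemimodule of K. -/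

import Mathlib

noncomputable section

open scoped Classical

/-- Max-plus matrix-vector product: `(A ⊗ x)_i = sup_j (A_{ij} + x_j)`. -/
def mpMulVec {N P : Type*} (A : N → P → EReal) (x : P → EReal) : N → EReal :=
  fun i => ⨆ j, A i j + x j

/-- Max-plus matrix-matrix product. -/
def mpMulMat {N P Q : Type*} (A : N → P → EReal) (B : P → Q → EReal) : N → Q → EReal :=
  fun i j => ⨆ k, A i k + B k j

/-- Max-plus identity matrix `E`. -/
def mpId {N : Type*} [DecidableEq N] : N → N → EReal :=
  fun i j => if i = j then (0 : EReal) else ⊥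

/-- Max-plus matrix powers: `A^0 = E`, `A^{k+1} = A^k ⊗ A`. -/
def mpPow {N : Type*} [DecidableEq N] (A : N → N → EReal) : ℕ → N → N → EReal
  | 0 => mpId
  | k + 1 => mpMulMat (mpPow A k) A

/-- Kleene star `A* = sup_{k ≥ 0} A^k` (entrywise supremum). -/
def mpStar {N : Type*} [DecidableEq N] (A : N → N → EReal) : N → N → EReal :=
  fun i j => ⨆ k : ℕ, mpPow A k i j

/-- Image of a matrix: `Im U = { U ⊗ u : u ∈ ℝ_max^P } ⊆ ℝ_max^N`. -/
def mpIm {N P : Type*} (U : N → P → EReal) : Set (N → EReal) :=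
  { x | (∀ i, x i ≠ ⊤) ∧ ∃ u : P → EReal, (∀ j, u j ≠ ⊤) ∧ x = mpMulVec U u }

/-- Existence of a positive-weight circuit in the precedence graph `G(A)`. -/
def hasPosCircuit {N : Type*} (A : N → N → EReal) : Prop :=
  ∃ (l : ℕ) (p : ℕ → N), p l = p 0 ∧ (∀ t < l, A (p (t + 1)) (p t) ≠ ⊥) ∧
    0 < ∑ t ∈ Finset.range l, A (p (t + 1)) (p t)

/-- The block-tridiagonal matrix `M_[K]` with diagonal blocks `C`,
superdiagonal blocks `L`, subdiagonal blocks `R`. -/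
def MK {n : ℕ} (L C R : Fin n → Fin n → EReal) (K : ℕ) :
    Fin K × Fin n → Fin K × Fin n → EReal :=
  fun p q =>
    if p.1.val = q.1.val then C p.2 q.2
    else if p.1.val + 1 = q.1.val then L p.2 q.2
    else if q.1.val + 1 = p.1.val then R p.2 q.2
    else ⊥

/-- The infinite block-tridiagonal matrix `M_[∞]`, indexed by `ℕ × Fin n`. -/
def Minf {n : ℕ} (L C R : Fin n → Fin n → EReal) :
    ℕ × Fin n → ℕ × Fin n → EReal :=
  fun p q =>
    if p.1 = q.1 then C p.2 q.2
    else if p.1 + 1 = q.1 then L p.2 q.2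
    else if q.1 + 1 = p.1 then R p.2 q.2
    else ⊥

/-- Existence of a finite real trajectory `x : {1,…,K} → ℝ^n` satisfying
`x(k) ≥ C ⊗ x(k)`, `x(k) ≥ L ⊗ x(k+1)` and `x(k+1) ≥ R ⊗ x(k)`. -/
def FiniteTraj {n : ℕ} (L C R : Fin n → Fin n → EReal) (K : ℕ) : Prop :=
  ∃ x : Fin K → Fin n → ℝ,
    (∀ k : Fin K, ∀ i, mpMulVec C (fun j => (x k j : EReal)) i ≤ (x k i : EReal)) ∧
    (∀ k : Fin K, ∀ h : k.val + 1 < K, ∀ i,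
      mpMulVec L (fun j => (x ⟨k.val + 1, h⟩ j : EReal)) i ≤ (x k i : EReal) ∧
      mpMulVec R (fun j => (x k j : EReal)) i ≤ (x ⟨k.val + 1, h⟩ i : EReal))

/-- Weak consistency of system (8). -/
def WeaklyConsistent {n : ℕ} (L C R : Fin n → Fin n → EReal) : Prop :=
  ∀ K : ℕ, FiniteTraj L C R K

/-- Consistency of system (8): existence of an infinite real trajectory. -/
def Consistent {n : ℕ} (L C R : Fin n → Fin n → EReal) : Prop :=
  ∃ x : ℕ → Fin n → ℝ, ∀ k : ℕ,
    (∀ i, mpMulVec L (fun j => (x (k + 1) j : EReal)) i ≤ (x k i : EReal)) ∧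
    (∀ i, mpMulVec C (fun j => (x k j : EReal)) i ≤ (x k i : EReal)) ∧
    (∀ i, mpMulVec R (fun j => (x k j : EReal)) i ≤ (x (k + 1) i : EReal))

/-- The sequence `Π_0 = C*`, `Π_{k+1} = (L ⊗ Π_k ⊗ R ⊕ C)*`. -/
def PiSeq {n : ℕ} (L C R : Fin n → Fin n → EReal) : ℕ → Fin n → Fin n → EReal
  | 0 => mpStar C
  | k + 1 => mpStar (fun i j => max (mpMulMat (mpMulMat L (PiSeq L C R k)) R i j) (C i j))

/-- Lifted matrix `Ā = [[ε, E], [ε, ε]]`. -/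
def Abar (n : ℕ) : Fin n ⊕ Fin n → Fin n ⊕ Fin n → EReal :=
  fun p q =>
    match p, q with
    | Sum.inl i, Sum.inr j => mpId i j
    | _, _ => ⊥

/-- Lifted matrix `B̄ = [ε; E]`. -/
def Bbar (n : ℕ) : Fin n ⊕ Fin n → Fin n → EReal :=
  fun p j =>
    match p with
    | Sum.inl _ => ⊥
    | Sum.inr i => mpId i j

/-- Lifted matrix `H = [[C, L], [R, C]]`. -/
def Hmat {n : ℕ} (L C R : Fin n → Fin n → EReal) :
    Fin n ⊕ Fin n → Fin n ⊕ Fin n → EReal :=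
  fun p q =>
    match p, q with
    | Sum.inl i, Sum.inl j => C i j
    | Sum.inl i, Sum.inr j => L i j
    | Sum.inr i, Sum.inl j => R i j
    | Sum.inr i, Sum.inr j => C i j

/-- The semimodule `K = Im H*`. -/
def Kset {n : ℕ} (L C R : Fin n → Fin n → EReal) : Set (Fin n ⊕ Fin n → EReal) :=
  mpIm (mpStar (Hmat L C R))

/-- The map `φ(X) = X ∩ { x ∈ ℝ_max^N : ∃ u ∈ ℝ_max^M, A ⊗ x ⊕ B ⊗ u ∈ X }`. -/
def mpPhi {N M : Type*} (A : N → N → EReal) (B : N → M → EReal)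
    (X : Set (N → EReal)) : Set (N → EReal) :=
  X ∩ { x | (∀ i, x i ≠ ⊤) ∧ ∃ u : M → EReal, (∀ j, u j ≠ ⊤) ∧
    (fun i => max (mpMulVec A x i) (mpMulVec B u i)) ∈ X }

/-- Controlled trajectory: `x(1) = x0`, `x(k+1) = A ⊗ x(k) ⊕ B ⊗ u(k)`. -/
def mpTraj {N M : Type*} (A : N → N → EReal) (B : N → M → EReal)
    (x0 : N → EReal) (u : ℕ → M → EReal) : ℕ → N → EReal
  | 0 => x0
  | k + 1 => fun i => max (mpMulVec A (mpTraj A B x0 u k) i) (mpMulVec B (u k) i)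

/-- `K^♯`: states of `K` from which some control keeps the whole trajectory in `K`. -/
def mpKsharp {N M : Type*} (A : N → N → EReal) (B : N → M → EReal)
    (K : Set (N → EReal)) : Set (N → EReal) :=
  { x | x ∈ K ∧ ∃ u : ℕ → M → EReal, (∀ k j, u k j ≠ ⊤) ∧
    ∀ k : ℕ, mpTraj A B x u k ∈ K }

/-- Real vectors `ℝ^N` inside `ℝ̄^N`. -/
def RealVecs {N : Type*} : Set (N → EReal) := { x | ∀ i, x i ≠ ⊤ ∧ x i ≠ ⊥ }

/-- Semimodules of `ℝ_max^N`: closed under entrywise max and scalar addition. -/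
def IsSemimodule {N : Type*} (X : Set (N → EReal)) : Prop :=
  (∀ x ∈ X, ∀ i, x i ≠ ⊤) ∧
  (∀ x ∈ X, ∀ y ∈ X, (fun i => max (x i) (y i)) ∈ X) ∧
  (∀ x ∈ X, ∀ lam : EReal, lam ≠ ⊤ → (fun i => lam + x i) ∈ X)

/-- Embedding of the first two block indices into `Fin (k+2) × Fin n`. -/
def emb2 {n : ℕ} (k : ℕ) : Fin n ⊕ Fin n → Fin (k + 2) × Fin n
  | Sum.inl i => (⟨0, by omega⟩, i)
  | Sum.inr i => (⟨1, by omega⟩, i)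

/-- `S_{k+2}`: top-left `2n × 2n` submatrix of `(M_[k+2])*`. -/
def Smat {n : ℕ} (L C R : Fin n → Fin n → EReal) (k : ℕ) :
    Fin n ⊕ Fin n → Fin n ⊕ Fin n → EReal :=
  fun p q => mpStar (MK L C R (k + 2)) (emb2 k p) (emb2 k q)

/-- Embedding of the first two block indices into `ℕ × Fin n`. -/
def embInf {n : ℕ} : Fin n ⊕ Fin n → ℕ × Fin n
  | Sum.inl i => (0, i)
  | Sum.inr i => (1, i)

/-- `S_∞`: top-left `2n × 2n` submatrix of `(M_[∞])*`. -/
def Sinf {n : ℕ} (L C R : Fin n → Fin n → EReal) :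
    Fin n ⊕ Fin n → Fin n ⊕ Fin n → EReal :=
  fun p q => mpStar (Minf L C R) (embInf p) (embInf q)

section ControlledInvariance

variable {N M : Type*} {A : N → N → EReal} {B : N → M → EReal} {K X : Set (N → EReal)}

theorem mpTraj_succ_eq_mpTraj_tail (A : N → N → EReal) (B : N → M → EReal)
    (x : N → EReal) (u : ℕ → M → EReal) (k : ℕ) :
    mpTraj A B x u (k + 1) = mpTraj A B (mpTraj A B x u 1) (fun l => u (l + 1)) k := by
  induction k with
  | zero => rfl
  | succ k ih => rw [mpTraj, ih]; rfl

theorem mpPhi_subset : mpPhi A B X ⊆ X := Set.inter_subset_left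

theorem mpPhi_iterate_subset (k : ℕ) : (mpPhi A B)^[k] K ⊆ K := by
  induction k with
  | zero => exact subset_rfl
  | succ k ih =>
    rw [Function.iterate_succ_apply']
    exact mpPhi_subset.trans ih

/-- One step along an admissible trajectory stays in `K^♯`. -/
theorem exists_control_mem_mpKsharp {x : N → EReal} (hx : x ∈ mpKsharp A B K) :
    ∃ u : M → EReal, (∀ j, u j ≠ ⊤) ∧
      (fun i => max (mpMulVec A x i) (mpMulVec B u i)) ∈ mpKsharp A B K := by
  obtain ⟨-, u, hu, hxu⟩ := hx
  refine ⟨u 0, hu 0, hxu 1, fun k => u (k + 1), fun k => hu (k + 1), fun k => ?_⟩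
  have h := hxu (k + 1)
  rwa [mpTraj_succ_eq_mpTraj_tail] at h

theorem mpKsharp_subset_mpPhi_iterate (hK : ∀ x ∈ K, ∀ i, x i ≠ ⊤) (k : ℕ) :
    mpKsharp A B K ⊆ (mpPhi A B)^[k] K := by
  induction k with
  | zero => exact fun x hx => hx.1
  | succ k ih =>
    rw [Function.iterate_succ_apply']
    intro x hx
    obtain ⟨u, hu, hxu⟩ := exists_control_mem_mpKsharp hx
    exact ⟨ih hx, hK x hx.1, u, hu, ih hxu⟩

/-- Every subset of `K` that `mpPhi` does not shrink is contained in `K^♯`. -/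
theorem subset_mpKsharp_of_subset_mpPhi (hXK : X ⊆ K) (hX : X ⊆ mpPhi A B X) :
    X ⊆ mpKsharp A B K := by
  have hex : ∀ x : N → EReal, ∃ u : M → EReal, x ∈ X → (∀ j, u j ≠ ⊤) ∧
      (fun i => max (mpMulVec A x i) (mpMulVec B u i)) ∈ X := by
    intro x
    by_cases hx : x ∈ X
    · obtain ⟨-, -, u, hu⟩ := hX hx
      exact ⟨u, fun _ => hu⟩
    · exact ⟨fun _ => ⊥, fun h => absurd h hx⟩
  choose g hg using hex
  intro x hx
  let f : (N → EReal) → N → EReal :=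
    fun y i => max (mpMulVec A y i) (mpMulVec B (g y) i)
  have hf : ∀ k, f^[k] x ∈ X := by
    intro k
    induction k with
    | zero => exact hx
    | succ k ih =>
      rw [Function.iterate_succ_apply']
      exact (hg _ ih).2
  have htraj : ∀ k, mpTraj A B x (fun l => g (f^[l] x)) k = f^[k] x := by
    intro k
    induction k with
    | zero => rfl
    | succ k ih => rw [mpTraj, ih, Function.iterate_succ_apply']
  refine ⟨hXK hx, fun l => g (f^[l] x), fun k => (hg _ (hf k)).1, fun k => ?_⟩
  rw [htraj]
  exact hXK (hf k)

end ControlledInvariance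

/-- (i) `K^♯ ⊆ φ^k(K)` for all `k`; (ii) if
`φ^{k+1}(K) = φ^k(K)` for some `k`, then `φ^k(K) = K^♯`, the maximal
`(A,B)`-invariant subsemimodule of `K`. -/
theorem stmt_16 (N M : Type*) (A : N → N → EReal) (B : N → M → EReal)
    (hA : ∀ i j, A i j ≠ ⊤) (hB : ∀ i j, B i j ≠ ⊤)
    (K : Set (N → EReal)) (hK : IsSemimodule K) :
    (∀ k : ℕ, mpKsharp A B K ⊆ (mpPhi A B)^[k] K) ∧
    (∀ k : ℕ, (mpPhi A B)^[k + 1] K = (mpPhi A B)^[k] K →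
      (mpPhi A B)^[k] K = mpKsharp A B K) := by
  refine ⟨mpKsharp_subset_mpPhi_iterate hK.1, fun k hk => ?_⟩
  rw [Function.iterate_succ_apply'] at hk
  exact (subset_mpKsharp_of_subset_mpPhi (mpPhi_iterate_subset k) hk.ge).antisymm
    (mpKsharp_subset_mpPhi_iterate hK.1 k)
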